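/- arXiv:cs/9901010 — 7 statements merged into one kernel-verified Lean document; each statement's English description precedes it below -/
import Mathlib

section
/- There exist an absolute constant c > 0 and an integer N such that for all n ≥ N, for every integer p with 1 ≤ p ≤ log₂ n, and for every integer M ≥ n·p: if C(M + np - 1, np - 1) ≥ n!/n⁴, then M ≥ c · p · n^{1 + 1/p}. -/
theorem pow_self_div_exp_le_factorial (n : ℕ) :
    ((n : ℝ) / Real.exp 1) ^ n ≤ (n.factorial : ℝ) := by
  have h := Real.pow_div_factorial_le_exp (n : ℝ) n.cast_nonneg n
  rw [div_le_iff₀ (by positivity)] at h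
  rw [div_pow, ← Real.exp_nat_mul, mul_one, div_le_iff₀ (Real.exp_pos _), mul_comm]
  exact h

theorem choose_pred_le_pow {k M : ℕ} (hk : 0 < k) (hkM : k ≤ M) :
    ((M + k - 1).choose (k - 1) : ℝ) ≤ (2 * Real.exp 1 * M / k) ^ k := by
  have pascal : (M + k - 1).choose (k - 1) ≤ (M + k).choose k := by
    obtain ⟨j, rfl⟩ := Nat.exists_eq_succ_of_ne_zero hk.ne'
    exact Nat.le.intro (Nat.choose_succ_succ (M + j) j).symm
  have hk' : (0 : ℝ) < k := by exact_mod_cast hk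
  calc ((M + k - 1).choose (k - 1) : ℝ) ≤ ((M + k).choose k : ℝ) := by exact_mod_cast pascal
    _ ≤ ((M + k : ℕ) : ℝ) ^ k / k.factorial := Nat.choose_le_pow_div k (M + k)
    _ ≤ (2 * M) ^ k / ((k : ℝ) / Real.exp 1) ^ k := by
        gcongr
        · have : (k : ℝ) ≤ M := by exact_mod_cast hkM
          push_cast
          linarith
        · exact pow_self_div_exp_le_factorial k
    _ = (2 * Real.exp 1 * M / k) ^ k := by
        rw [← div_pow]
        congr 1
        field_simp

theorem pow_div_exp_five_le_factorial_div {n : ℕ} (hn : 0 < n) :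
    ((n : ℝ) / Real.exp 5) ^ n ≤ (n.factorial : ℝ) / (n : ℝ) ^ 4 := by
  have hn' : (0 : ℝ) < n := by exact_mod_cast hn
  have quartic : (n : ℝ) ^ 4 ≤ Real.exp 4 ^ n := by
    calc (n : ℝ) ^ 4 ≤ Real.exp n ^ 4 := by
          gcongr
          linarith [Real.add_one_le_exp (n : ℝ)]
      _ = Real.exp 4 ^ n := by
          rw [← Real.exp_nat_mul, ← Real.exp_nat_mul]
          push_cast
          ring_nf
  calc ((n : ℝ) / Real.exp 5) ^ n = ((n : ℝ) / Real.exp 1) ^ n / Real.exp 4 ^ n := by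
        rw [← div_pow, div_div, ← Real.exp_add]
        norm_num
    _ ≤ (n.factorial : ℝ) / (n : ℝ) ^ 4 := by
        gcongr
        exact pow_self_div_exp_le_factorial n

/-- **Combinatorial core of the Shellsort average-case lower bound.**
There exist a constant `c > 0` and an integer `N` such that for all `n ≥ N`,
every integer `p` with `1 ≤ p ≤ log₂ n`, and every integer `M ≥ n·p`:
if `C(M + np - 1, np - 1) ≥ n!/n⁴` then `M ≥ c · p · n^{1 + 1/p}`. -/
theorem stmt_4 : ∃ c : ℝ, 0 < c ∧ ∃ N : ℕ, ∀ n : ℕ, N ≤ n → ∀ p : ℕ, 1 ≤ p →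
    (p : ℝ) ≤ Real.logb 2 n → ∀ M : ℕ, n * p ≤ M →
    (n.factorial : ℝ) / (n : ℝ) ^ 4 ≤ ((M + n * p - 1).choose (n * p - 1) : ℝ) →
    c * (p : ℝ) * (n : ℝ) ^ (1 + 1 / (p : ℝ)) ≤ (M : ℝ) := by
  refine ⟨1 / (2 * Real.exp 6), by positivity, 1, fun n hn p hp _ M hM h => ?_⟩
  have hn' : (0 : ℝ) < n := by exact_mod_cast hn
  have hp' : (0 : ℝ) < p := by exact_mod_cast hp
  set y : ℝ := 2 * Real.exp 1 * M / (n * p : ℕ) with hy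
  have hy0 : 0 ≤ y := by positivity
  have pow_bound : (n : ℝ) / Real.exp 5 ≤ y ^ p := by
    refine le_of_pow_le_pow_left₀ (n := n) (by omega) (by positivity) ?_
    rw [← pow_mul, mul_comm p n]
    exact (pow_div_exp_five_le_factorial_div hn).trans
      (h.trans (choose_pred_le_pow (Nat.mul_pos hn hp) hM))
  have n_le : (n : ℝ) ≤ (Real.exp 5 * y) ^ p := by
    rw [div_le_iff₀ (Real.exp_pos _)] at pow_bound
    rw [mul_pow]
    have : Real.exp 5 ≤ Real.exp 5 ^ p :=
      le_self_pow₀ (Real.one_le_exp (by norm_num)) (by omega)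
    nlinarith [pow_nonneg hy0 p]
  have root_le : (n : ℝ) ^ (1 / (p : ℝ)) ≤ Real.exp 5 * y := by
    rw [one_div]
    exact (Real.rpow_inv_le_iff_of_pos hn'.le (by positivity) hp').2
      (by rwa [Real.rpow_natCast])
  have exp_six : Real.exp 6 = Real.exp 5 * Real.exp 1 := by
    rw [← Real.exp_add]
    norm_num
  rw [Real.rpow_add hn', Real.rpow_one]
  calc 1 / (2 * Real.exp 6) * (p : ℝ) * (n * (n : ℝ) ^ (1 / (p : ℝ)))
      ≤ 1 / (2 * Real.exp 6) * (p : ℝ) * (n * (Real.exp 5 * y)) := by gcongr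
    _ = M := by
        rw [hy, exp_six]
        push_cast
        field_simp
end

section
/- For every real δ > 0 there is an integer N such that for all n ≥ N, the number of permutations π of {1,…,n} with LIS(π) ≥ (1+δ)·e·√n is at most n!/n. In particular, all but a vanishing fraction of permutations have no increasing subsequence longer than (1+δ)·e·√n. -/
/-- `LIS π` is the maximum length of an increasing subsequence of the permutation `π`
of `{1,…,n}`: the largest `m` for which there are indices `i₁ < … < i_m` with
`π i₁ < … < π i_m`. -/
noncomputable def LIS {n : ℕ} (π : Equiv.Perm (Fin n)) : ℕ :=
  sSup {m : ℕ | ∃ s : Fin m → Fin n, StrictMono s ∧ StrictMono (fun i => π (s i))}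

theorem exists_strictMono_of_le_LIS {n m : ℕ} {π : Equiv.Perm (Fin n)} (h : m ≤ LIS π) :
    ∃ s : Fin m → Fin n, StrictMono s ∧ StrictMono (fun i => π (s i)) := by
  obtain ⟨s, hs, hπ⟩ : LIS π ∈ {m : ℕ | ∃ s : Fin m → Fin n,
      StrictMono s ∧ StrictMono (fun i => π (s i))} := by
    refine Nat.sSup_mem ⟨0, Fin.elim0, fun i => i.elim0, fun i => i.elim0⟩ ⟨n, ?_⟩
    rintro k ⟨s, hs, -⟩
    simpa using Fintype.card_le_of_injective s hs.injective
  exact ⟨fun i => s (Fin.castLE h i), fun _ _ hij => hs hij, fun _ _ hij => hπ hij⟩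

open Classical in
/-- At most `n! / m!` permutations are increasing along a given injective sequence
of `m` indices. -/
theorem card_strictMono_comp_mul_factorial_le {n m : ℕ} (s : Fin m ↪ Fin n) :
    (Finset.univ.filter fun π : Equiv.Perm (Fin n) => StrictMono (fun i => π (s i))).card
      * m.factorial ≤ n.factorial := by
  have key : Function.Injective
      (fun p : {π : Equiv.Perm (Fin n) // StrictMono (fun i => π (s i))} × Equiv.Perm (Fin m) =>
        p.1.1 * p.2.viaEmbedding s) := by
    rintro ⟨⟨π, hπ⟩, σ⟩ ⟨⟨π', hπ'⟩, τ⟩ h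
    have hcomp : ∀ i, π (s (σ i)) = π' (s (τ i)) := fun i => by
      simpa [Equiv.Perm.viaEmbedding_apply] using
        congrArg (fun ρ : Equiv.Perm (Fin n) => ρ (s i)) h
    have hrange : Set.range (fun i => π (s i)) = Set.range (fun i => π' (s i)) := by
      rw [← σ.surjective.range_comp, ← τ.surjective.range_comp (fun i => π' (s i))]
      exact congrArg Set.range (funext hcomp)
    have hfun := (hπ.range_inj hπ').1 hrange
    have hστ : σ = τ := Equiv.ext fun i =>
      hπ'.injective ((congrFun hfun (σ i)).symm.trans (hcomp i))
    subst hστ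
    have hππ' : π = π' := mul_right_cancel h
    subst hππ'
    rfl
  simpa [Fintype.card_perm, Fintype.card_subtype] using Fintype.card_le_of_injective _ key

theorem ncard_le_LIS_mul_factorial_le (n m : ℕ) :
    {π : Equiv.Perm (Fin n) | m ≤ LIS π}.ncard * m.factorial
      ≤ n.choose m * n.factorial := by
  classical
  let F : Finset (Fin n) → Finset (Equiv.Perm (Fin n)) := fun S =>
    if hS : S.card = m then
      Finset.univ.filter fun π => StrictMono (fun i => π (S.orderEmbOfFin hS i))
    else ∅
  have hsub : {π : Equiv.Perm (Fin n) | m ≤ LIS π} ⊆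
      ((Finset.powersetCard m Finset.univ).biUnion F : Finset (Equiv.Perm (Fin n))) := by
    intro π hπ
    obtain ⟨s, hs, hsπ⟩ := exists_strictMono_of_le_LIS hπ
    have hcard : (Finset.univ.image s).card = m := by
      simp [Finset.card_image_of_injective _ hs.injective]
    have hemb : s = (Finset.univ.image s).orderEmbOfFin hcard :=
      Finset.orderEmbOfFin_unique hcard (fun i => by simp) hs
    refine Finset.mem_coe.2 (Finset.mem_biUnion.2 ⟨Finset.univ.image s, ?_, ?_⟩)
    · simp [Finset.mem_powersetCard, hcard]
    · simp only [F, dif_pos hcard, Finset.mem_filter, Finset.mem_univ, true_and]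
      rwa [← hemb]
  calc {π : Equiv.Perm (Fin n) | m ≤ LIS π}.ncard * m.factorial
      ≤ ((Finset.powersetCard m Finset.univ).biUnion F).card * m.factorial := by
        gcongr
        simpa only [Set.ncard_coe_finset] using Set.ncard_le_ncard hsub (Finset.finite_toSet _)
    _ ≤ (∑ S ∈ Finset.powersetCard m Finset.univ, (F S).card) * m.factorial := by
        gcongr
        exact Finset.card_biUnion_le
    _ = ∑ S ∈ Finset.powersetCard m Finset.univ, (F S).card * m.factorial := Finset.sum_mul ..
    _ ≤ ∑ S ∈ Finset.powersetCard m (Finset.univ : Finset (Fin n)), n.factorial := by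
        refine Finset.sum_le_sum fun S hS => ?_
        have hcard := (Finset.mem_powersetCard.1 hS).2
        simp only [F, dif_pos hcard]
        exact card_strictMono_comp_mul_factorial_le (S.orderEmbOfFin hcard).toEmbedding
    _ = n.choose m * n.factorial := by simp

theorem choose_div_factorial_le {n m : ℕ} (hm : 0 < m) :
    (n.choose m : ℝ) / m.factorial ≤ (Real.exp 1 * √n / m) ^ (2 * m) := by
  have hm' : (0 : ℝ) < m := by exact_mod_cast hm
  have hexp : (m : ℝ) ^ m / m.factorial ≤ Real.exp 1 ^ m := by
    simpa [← Real.exp_nat_mul] using Real.pow_div_factorial_le_exp (m : ℝ) hm'.le m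
  have hinv : 1 / (m.factorial : ℝ) ≤ (Real.exp 1 / m) ^ m := by
    rw [div_pow, le_div_iff₀ (by positivity)]
    calc _ = (m : ℝ) ^ m / m.factorial := by ring
      _ ≤ _ := hexp
  calc (n.choose m : ℝ) / m.factorial ≤ ((n : ℝ) ^ m / m.factorial) / m.factorial := by
        gcongr
        exact Nat.choose_le_pow_div m n
    _ = (n : ℝ) ^ m * (1 / m.factorial) ^ 2 := by ring
    _ ≤ (n : ℝ) ^ m * ((Real.exp 1 / m) ^ m) ^ 2 := by gcongr
    _ = (Real.exp 1 * √n / m) ^ (2 * m) := by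
        rw [pow_mul, div_pow (_ * _), mul_pow, Real.sq_sqrt n.cast_nonneg]
        simp only [div_pow, mul_pow]
        ring

/-- For every `δ > 0`, for all sufficiently large `n`, the number of permutations `π`
of `{1,…,n}` with `LIS π ≥ (1+δ)·e·√n` is at most `n!/n`: all but a vanishing fraction
of permutations have no increasing subsequence longer than `(1+δ)·e·√n`. -/
theorem stmt_13 : ∀ δ : ℝ, 0 < δ → ∃ N : ℕ, ∀ n : ℕ, N ≤ n →
    ({π : Equiv.Perm (Fin n) |
        (1 + δ) * Real.exp 1 * Real.sqrt n ≤ (LIS π : ℝ)}.ncard : ℝ)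
      ≤ (n.factorial : ℝ) / (n : ℝ) := by
  intro δ hδ
  set r : ℝ := (1 + δ)⁻¹ with hr
  have hr0 : 0 < r := by positivity
  have hr1 : r < 1 := inv_lt_one_of_one_lt₀ (by linarith)
  obtain ⟨M, hM⟩ := Filter.eventually_atTop.1
    ((tendsto_pow_const_mul_const_pow_of_lt_one 2 hr0.le hr1).eventually_lt_const one_pos)
  refine ⟨M ^ 2 + 1, fun n hn => ?_⟩
  have hn0 : (0 : ℝ) < n := by exact_mod_cast (show 0 < n by omega)
  have hsqrt : 0 < √(n : ℝ) := Real.sqrt_pos.2 hn0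
  set m := ⌈(1 + δ) * Real.exp 1 * √n⌉₊ with hmdef
  have hm : (1 + δ) * Real.exp 1 * √n ≤ m := Nat.le_ceil _
  have hme : √(n : ℝ) ≤ m := by
    have h1 : 1 ≤ (1 + δ) * Real.exp 1 :=
      one_le_mul_of_one_le_of_one_le (by linarith) (Real.one_le_exp zero_le_one)
    nlinarith
  have hm0 : (0 : ℝ) < m := hsqrt.trans_le hme
  have hMm : M ≤ m := by
    have : (M : ℝ) ≤ √n := Real.le_sqrt_of_sq_le (by exact_mod_cast (show M ^ 2 ≤ n by omega))
    exact_mod_cast this.trans hme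
  have hnm : (n : ℝ) ≤ (m : ℝ) ^ 2 := (Real.sqrt_le_left hm0.le).1 hme
  have hset : {π : Equiv.Perm (Fin n) | (1 + δ) * Real.exp 1 * √n ≤ (LIS π : ℝ)} =
      {π | m ≤ LIS π} := by
    simp only [hmdef, Nat.ceil_le]
  have hcount : ({π : Equiv.Perm (Fin n) | m ≤ LIS π}.ncard : ℝ) * m.factorial
      ≤ n.choose m * n.factorial := by exact_mod_cast ncard_le_LIS_mul_factorial_le n m
  have hbase : Real.exp 1 * √n / m ≤ r := by
    rw [div_le_iff₀ hm0, hr, inv_mul_eq_div, le_div_iff₀ (by linarith)]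
    linarith
  have hratio : (n.choose m : ℝ) / m.factorial ≤ 1 / n := by
    rw [le_div_iff₀ hn0]
    calc (n.choose m : ℝ) / m.factorial * n ≤ r ^ (2 * m) * (m : ℝ) ^ 2 := by
          gcongr
          exact (choose_div_factorial_le (by exact_mod_cast hm0)).trans (by gcongr)
      _ ≤ r ^ m * (m : ℝ) ^ 2 := by
          gcongr ?_ * _
          exact pow_le_pow_of_le_one hr0.le hr1.le (by omega)
      _ ≤ 1 := by linarith [hM m hMm]
  rw [hset]
  calc _ ≤ (n.choose m : ℝ) * n.factorial / m.factorial := by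
        rwa [le_div_iff₀ (by positivity)]
    _ = (n.choose m : ℝ) / m.factorial * n.factorial := by ring
    _ ≤ 1 / n * n.factorial := by gcongr
    _ = n.factorial / n := by ring
end

section
/- There exist an absolute constant C > 0 and an integer N such that for all n ≥ N, the sum over all permutations π of {1,…,n} of LIS(π) satisfies Σ_π LIS(π) ≤ C · √n · n!. In particular, the average number of parallel stacks used by Parallel-Stack-Sort, which is at most LIS(π) on input π, is O(√n) under the uniform distribution on permutations. -/
open Finset in
/-- At most a `1 / #S !` fraction of all permutations is increasing on a given set `S`. -/
theorem card_strictMonoOn_mul_factorial_le {n : ℕ} (S : Finset (Fin n)) :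
    #{π : Equiv.Perm (Fin n) | StrictMonoOn π S} * (#S).factorial ≤ n.factorial := by
  let s : Fin #S ↪o Fin n := S.orderEmbOfFin rfl
  have hs : ∀ i, s i ∈ S := S.orderEmbOfFin_mem rfl
  have hcard : #(({π : Equiv.Perm (Fin n) | StrictMonoOn π S} : Finset _) ×ˢ
      (univ : Finset (Equiv.Perm (Fin #S)))) ≤ #(univ : Finset (Equiv.Perm (Fin n))) := by
    refine card_le_card_of_injOn (fun p => p.1 * p.2.viaEmbedding s.toEmbedding)
      (fun _ _ => mem_coe.2 (mem_univ _)) ?_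
    rintro ⟨π, τ⟩ hπ ⟨ρ, σ⟩ hρ h
    simp only [coe_product, Set.mem_prod, mem_coe, mem_filter, mem_univ, true_and,
      and_true] at hπ hρ h
    have happ : ∀ i, π (s (τ i)) = ρ (s (σ i)) := fun i => by
      have hi := congrArg (fun e : Equiv.Perm (Fin n) => e (s.toEmbedding i)) h
      simp only [Equiv.Perm.mul_apply, Equiv.Perm.viaEmbedding_apply] at hi
      exact hi
    have hπs : StrictMono (fun i => π (s i)) := fun i j hij =>
      hπ (hs i) (hs j) (s.strictMono hij)
    have hρs : StrictMono (fun i => ρ (s i)) := fun i j hij =>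
      hρ (hs i) (hs j) (s.strictMono hij)
    have hrange : Set.range (fun i => π (s i)) = Set.range (fun i => ρ (s i)) := by
      rw [← τ.surjective.range_comp, ← σ.surjective.range_comp (fun i => ρ (s i))]
      exact congrArg Set.range (funext happ)
    have heq : (fun i => π (s i)) = fun i => ρ (s i) := (hπs.range_inj hρs).1 hrange
    have hτ : τ = σ := Equiv.ext fun i =>
      hρs.injective ((congrFun heq (τ i)).symm.trans (happ i))
    subst hτ
    exact Prod.ext (mul_right_cancel h) rfl
  simpa [card_product, Fintype.card_perm] using hcard

theorem LIS_le {n : ℕ} (π : Equiv.Perm (Fin n)) : LIS π ≤ n := by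
  refine csSup_le ⟨0, Fin.elim0, fun i => i.elim0, fun i => i.elim0⟩ ?_
  rintro m ⟨s, hs, -⟩
  simpa using Fintype.card_le_of_injective s hs.injective

open Finset in
theorem exists_strictMonoOn_of_le_LIS {n k : ℕ} {π : Equiv.Perm (Fin n)} (hk : k ≤ LIS π) :
    ∃ S : Finset (Fin n), #S = k ∧ StrictMonoOn π S := by
  obtain ⟨s, hs, hπs⟩ : LIS π ∈ {m : ℕ | ∃ s : Fin m → Fin n, StrictMono s ∧
      StrictMono (fun i => π (s i))} := by
    refine Nat.sSup_mem ⟨0, Fin.elim0, fun i => i.elim0, fun i => i.elim0⟩ ⟨n, ?_⟩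
    rintro m ⟨s, hs, -⟩
    simpa using Fintype.card_le_of_injective s hs.injective
  obtain ⟨S, hS, hcard⟩ := exists_subset_card_eq (s := univ.image s) (n := k)
    (by simpa [card_image_of_injective _ hs.injective] using hk)
  refine ⟨S, hcard, fun x hx y hy hxy => ?_⟩
  obtain ⟨i, -, rfl⟩ := mem_image.1 (hS hx)
  obtain ⟨j, -, rfl⟩ := mem_image.1 (hS hy)
  exact hπs (hs.lt_iff_lt.1 hxy)

open Finset in
/-- First-moment bound on the number of permutations with a long increasing subsequence. -/
theorem card_le_LIS_mul_factorial_le (n k : ℕ) :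
    #{π : Equiv.Perm (Fin n) | k ≤ LIS π} * k.factorial ≤ n.choose k * n.factorial := by
  have hsub : ({π : Equiv.Perm (Fin n) | k ≤ LIS π} : Finset _) ⊆
      (powersetCard k univ).biUnion fun S : Finset (Fin n) =>
        {π : Equiv.Perm (Fin n) | StrictMonoOn π S} := by
    intro π hπ
    obtain ⟨S, hS, hmono⟩ := exists_strictMonoOn_of_le_LIS (mem_filter.1 hπ).2
    exact mem_biUnion.2 ⟨S, by simp [hS], by simpa using hmono⟩
  calc _ ≤ (∑ S ∈ powersetCard k (univ : Finset (Fin n)),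
        #{π : Equiv.Perm (Fin n) | StrictMonoOn π S}) * k.factorial :=
        Nat.mul_le_mul_right _ ((card_le_card hsub).trans card_biUnion_le)
    _ = ∑ S ∈ powersetCard k (univ : Finset (Fin n)),
        #{π : Equiv.Perm (Fin n) | StrictMonoOn π S} * k.factorial := sum_mul ..
    _ ≤ ∑ S ∈ powersetCard k (univ : Finset (Fin n)), n.factorial :=
        sum_le_sum fun S hS => by
          rw [← (mem_powersetCard.1 hS).2]
          exact card_strictMonoOn_mul_factorial_le S
    _ = n.choose k * n.factorial := by simp

/-- For `k ≥ 6 √n`, the first-moment bound `n.choose k / k!` is at most `1 / n`. -/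
theorem mul_choose_le_factorial {n k : ℕ} (hk : 36 * n ≤ k ^ 2) :
    (n : ℝ) * n.choose k ≤ k.factorial := by
  have hf : (0 : ℝ) < k.factorial := by positivity
  have hkR : 36 * (n : ℝ) ≤ (k : ℝ) ^ 2 := by exact_mod_cast hk
  have hexp : (k : ℝ) ^ k ≤ 3 ^ k * k.factorial := by
    have h := Real.pow_div_factorial_le_exp (k : ℝ) (Nat.cast_nonneg k) k
    rw [div_le_iff₀ hf, ← Real.exp_one_pow] at h
    have h3 : Real.exp 1 ≤ 3 := by linarith [Real.exp_one_lt_d9]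
    exact h.trans (by gcongr)
  have hn : (n : ℝ) ≤ 4 ^ k := by
    have h2 : (k : ℝ) ≤ 2 ^ k := by exact_mod_cast Nat.lt_two_pow_self.le
    have h4 : (k : ℝ) ^ 2 ≤ (2 ^ k) ^ 2 := by gcongr
    rw [← pow_mul, mul_comm k, pow_mul] at h4
    norm_num at h4
    linarith [(Nat.cast_nonneg n : (0 : ℝ) ≤ n)]
  have hpow : (36 : ℝ) ^ k * (n : ℝ) ^ k ≤ 9 ^ k * (k.factorial : ℝ) ^ 2 := by
    calc (36 : ℝ) ^ k * (n : ℝ) ^ k = (36 * n) ^ k := (mul_pow ..).symm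
      _ ≤ ((k : ℝ) ^ 2) ^ k := by gcongr
      _ = ((k : ℝ) ^ k) ^ 2 := pow_right_comm ..
      _ ≤ (3 ^ k * k.factorial) ^ 2 := by gcongr
      _ = 9 ^ k * (k.factorial : ℝ) ^ 2 := by
        rw [mul_pow, pow_right_comm]; norm_num
  have hmain : (4 : ℝ) ^ k * (n : ℝ) ^ k ≤ (k.factorial : ℝ) ^ 2 := by
    have h36 : (36 : ℝ) ^ k = 9 ^ k * 4 ^ k := by rw [← mul_pow]; norm_num
    rw [h36, mul_assoc] at hpow
    exact le_of_mul_le_mul_left hpow (by positivity)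
  calc (n : ℝ) * n.choose k ≤ 4 ^ k * ((n : ℝ) ^ k / k.factorial) := by
        gcongr
        exact Nat.choose_le_pow_div k n
    _ ≤ k.factorial := by
        rw [← mul_div_assoc, div_le_iff₀ hf, ← sq]
        exact hmain

/-- **Average-case upper bound for Parallel-Stack-Sort.** There are a constant `C > 0`
and an integer `N` such that for all `n ≥ N`, `Σ_π LIS(π) ≤ C·√n·n!`; since
Parallel-Stack-Sort uses at most `LIS π` stacks on input `π`, its average number of
stacks under the uniform distribution is `O(√n)`. -/
theorem stmt_15 : ∃ C : ℝ, 0 < C ∧ ∃ N : ℕ, ∀ n : ℕ, N ≤ n →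
    (∑ π : Equiv.Perm (Fin n), (LIS π : ℝ)) ≤ C * Real.sqrt n * (n.factorial : ℝ) := by
  refine ⟨8, by norm_num, 1, fun n hn => ?_⟩
  have hsqrt : 1 ≤ Real.sqrt n := Real.one_le_sqrt.2 (by exact_mod_cast hn)
  set k : ℕ := ⌈6 * Real.sqrt n⌉₊
  have hk_le : (k : ℝ) ≤ 6 * Real.sqrt n + 1 := (Nat.ceil_lt_add_one (by positivity)).le
  have hk : 36 * n ≤ k ^ 2 := by
    have h : (6 * Real.sqrt n) ^ 2 ≤ (k : ℝ) ^ 2 := by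
      gcongr
      exact Nat.le_ceil _
    rw [mul_pow, Real.sq_sqrt (Nat.cast_nonneg n)] at h
    norm_num at h
    exact_mod_cast h
  have htail : (n : ℝ) * (Finset.card {π : Equiv.Perm (Fin n) | k ≤ LIS π}) ≤ n.factorial := by
    have hcard : ((Finset.card {π : Equiv.Perm (Fin n) | k ≤ LIS π} : ℕ) : ℝ) * k.factorial ≤
        n.choose k * n.factorial := by exact_mod_cast card_le_LIS_mul_factorial_le n k
    refine le_of_mul_le_mul_right ?_ (by positivity : (0 : ℝ) < k.factorial)
    calc _ = (n : ℝ) * ((Finset.card {π : Equiv.Perm (Fin n) | k ≤ LIS π} : ℕ) *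
          k.factorial) := mul_assoc ..
      _ ≤ n * (n.choose k * n.factorial) := by gcongr
      _ = n * n.choose k * n.factorial := (mul_assoc ..).symm
      _ ≤ k.factorial * n.factorial := by
        gcongr
        exact mul_choose_le_factorial hk
      _ = n.factorial * k.factorial := mul_comm ..
  have hpoint : ∀ π : Equiv.Perm (Fin n),
      (LIS π : ℝ) ≤ k + n * (if k ≤ LIS π then 1 else 0) := by
    intro π
    split_ifs with h
    · have : (LIS π : ℝ) ≤ n := by exact_mod_cast LIS_le π
      linarith [(Nat.cast_nonneg k : (0 : ℝ) ≤ k)]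
    · have : (LIS π : ℝ) ≤ k := by exact_mod_cast (not_le.1 h).le
      simpa using this
  calc (∑ π : Equiv.Perm (Fin n), (LIS π : ℝ))
      ≤ ∑ π : Equiv.Perm (Fin n), (k + n * (if k ≤ LIS π then 1 else 0) : ℝ) :=
        Finset.sum_le_sum fun π _ => hpoint π
    _ = n.factorial * k + n * (Finset.card {π : Equiv.Perm (Fin n) | k ≤ LIS π}) := by
        rw [Finset.sum_add_distrib, ← Finset.mul_sum, Finset.sum_boole]
        simp [Fintype.card_perm]
    _ ≤ n.factorial * (6 * Real.sqrt n + 1) + n.factorial := by gcongr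
    _ = (6 * Real.sqrt n + 2) * n.factorial := by ring
    _ ≤ 8 * Real.sqrt n * n.factorial := by
        gcongr
        linarith
end

section
/- Let n, T ≥ 1 and suppose there is an injective map from the set of permutations of {1,…,n} into the set of sequences of length 2n over an alphabet of size 2T (e.g., recording for each step either 'push to stack i' or 'pop stack j' with i, j ∈ {1,…,T}). Then n! ≤ (2T)^{2n}, and hence T ≥ (n!)^{1/(2n)}/2; in particular there is a constant c > 0 such that T ≥ c·√n for all n ≥ 1. Consequently, any algorithm sorting all permutations of {1,…,n} with T parallel stacks requires T = Ω(√n). -/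
/-- **Counting core of the lower bound for sorting with `T` parallel stacks.**
If the permutations of `{1,…,n}` inject into sequences of length `2n` over an alphabet
of size `2T` (each move being `push to stack i` or `pop stack j`, `i,j ∈ {1,…,T}`),
then `n! ≤ (2T)^{2n}`, hence `T ≥ (n!)^{1/(2n)}/2`, and in particular `T ≥ c·√n` for
an absolute constant `c > 0`. -/
theorem stmt_16 : ∃ c : ℝ, 0 < c ∧ ∀ n T : ℕ, 1 ≤ n → 1 ≤ T →
    ∀ f : Equiv.Perm (Fin n) → (Fin (2 * n) → Fin (2 * T)),
    Function.Injective f →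
      n.factorial ≤ (2 * T) ^ (2 * n) ∧
      (n.factorial : ℝ) ^ (1 / (2 * (n : ℝ))) / 2 ≤ (T : ℝ) ∧
      c * Real.sqrt n ≤ (T : ℝ) := by
  refine ⟨1 / 4, by norm_num, fun n T hn _ f hf ↦ ?_⟩
  have hcard : n.factorial ≤ (2 * T) ^ (2 * n) := by
    simpa [Fintype.card_perm] using Fintype.card_le_of_injective f hf
  have hcardR : (n.factorial : ℝ) ≤ (2 * (T : ℝ)) ^ (2 * n) := by exact_mod_cast hcard
  have hn0 : n ≠ 0 := by lia
  refine ⟨hcard, ?_, ?_⟩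
  · have hroot : (n.factorial : ℝ) ^ (1 / (2 * (n : ℝ))) ≤ 2 * T := by
      calc (n.factorial : ℝ) ^ (1 / (2 * (n : ℝ)))
          ≤ ((2 * (T : ℝ)) ^ (2 * n)) ^ (1 / (2 * (n : ℝ))) := by gcongr
        _ = ((2 * (T : ℝ)) ^ (2 * n)) ^ (((2 * n : ℕ) : ℝ)⁻¹) := by
          rw [one_div]; push_cast; rfl
        _ = 2 * T := Real.pow_rpow_inv_natCast (by positivity) (by lia)
    linarith
  · have hpow : (n : ℝ) ^ n ≤ (16 * (T : ℝ) ^ 2) ^ n := by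
      have hexp : (n : ℝ) ^ n ≤ Real.exp n * n.factorial :=
        (div_le_iff₀ (by positivity)).1
          (Real.pow_div_factorial_le_exp (n : ℝ) (Nat.cast_nonneg n) n)
      have hexp_four : Real.exp n ≤ 4 ^ n := by
        rw [← Real.exp_one_pow]
        gcongr
        linarith [Real.exp_one_lt_d9]
      calc (n : ℝ) ^ n ≤ Real.exp n * n.factorial := hexp
        _ ≤ 4 ^ n * (2 * (T : ℝ)) ^ (2 * n) := by gcongr
        _ = (16 * (T : ℝ) ^ 2) ^ n := by
          rw [pow_mul, ← mul_pow]
          ring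
    have hle : (n : ℝ) ≤ 16 * (T : ℝ) ^ 2 := le_of_pow_le_pow_left₀ hn0 (by positivity) hpow
    have hsqrt : √(n : ℝ) ≤ 4 * T := Real.sqrt_le_iff.2 ⟨by positivity, by linarith⟩
    linarith
end

section
/- There exist an absolute constant c > 0 and an integer N such that for all n ≥ N, the sum over all permutations π of {1,…,n} of LIS(π) satisfies Σ_π LIS(π) ≥ c · √n · n!. In particular, since the minimum number of parallel stacks needed to sort π equals the length of its longest increasing subsequence, the average number of parallel stacks required to sort a permutation is Ω(√n). -/
theorem card_le_LIS {n : ℕ} (π : Equiv.Perm (Fin n)) (t : Finset (Fin n))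
    (ht : StrictMonoOn π (t : Set (Fin n))) : t.card ≤ LIS π := by
  refine le_csSup ⟨n, ?_⟩ ⟨t.orderEmbOfFin rfl, (t.orderEmbOfFin rfl).strictMono, ?_⟩
  · rintro m ⟨s, hs, -⟩
    simpa using Fintype.card_le_of_injective s hs.injective
  · intro i j hij
    exact ht (t.orderEmbOfFin_mem rfl i) (t.orderEmbOfFin_mem rfl j)
      ((t.orderEmbOfFin rfl).strictMono hij)

open Classical in
/-- The maximum length of an increasing subsequence of `π` that ends at position `i`. -/
noncomputable def lisEndingAt {n : ℕ} (π : Equiv.Perm (Fin n)) (i : Fin n) : ℕ :=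
  (Finset.univ.filter fun t : Finset (Fin n) =>
    StrictMonoOn π (t : Set (Fin n)) ∧ IsGreatest (t : Set (Fin n)) i).sup Finset.card

theorem card_le_lisEndingAt {n : ℕ} {π : Equiv.Perm (Fin n)} {i : Fin n} {t : Finset (Fin n)}
    (ht : StrictMonoOn π (t : Set (Fin n))) (hi : IsGreatest (t : Set (Fin n)) i) :
    t.card ≤ lisEndingAt π i := by
  classical
  exact Finset.le_sup (f := Finset.card) (Finset.mem_filter.2 ⟨Finset.mem_univ t, ht, hi⟩)

theorem exists_card_eq_lisEndingAt {n : ℕ} (π : Equiv.Perm (Fin n)) (i : Fin n) :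
    ∃ t : Finset (Fin n), StrictMonoOn π (t : Set (Fin n)) ∧ IsGreatest (t : Set (Fin n)) i ∧
      t.card = lisEndingAt π i := by
  classical
  obtain ⟨t, ht, h⟩ := Finset.exists_mem_eq_sup
    (Finset.univ.filter fun t : Finset (Fin n) =>
      StrictMonoOn π (t : Set (Fin n)) ∧ IsGreatest (t : Set (Fin n)) i)
    ⟨{i}, by simp [isGreatest_singleton]⟩ Finset.card
  rw [Finset.mem_filter] at ht
  exact ⟨t, ht.2.1, ht.2.2, by rw [← h, lisEndingAt]⟩

theorem lisEndingAt_mem_Icc {n : ℕ} (π : Equiv.Perm (Fin n)) (i : Fin n) :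
    lisEndingAt π i ∈ Finset.Icc 1 (LIS π) := by
  obtain ⟨t, ht, hi, h⟩ := exists_card_eq_lisEndingAt π i
  rw [Finset.mem_Icc, ← h]
  exact ⟨Finset.card_pos.2 ⟨i, hi.1⟩, card_le_LIS π t ht⟩

theorem lisEndingAt_lt {n : ℕ} {π : Equiv.Perm (Fin n)} {i j : Fin n} (hij : i < j)
    (h : π i < π j) : lisEndingAt π i < lisEndingAt π j := by
  obtain ⟨t, ht, hi, hc⟩ := exists_card_eq_lisEndingAt π i
  have lt_j : ∀ k ∈ t, k < j := fun k hk => (hi.2 hk).trans_lt hij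
  have hj : j ∉ t := fun hj => (lt_j j hj).false
  rw [← hc, ← Nat.succ_le_iff, Nat.succ_eq_add_one, ← Finset.card_insert_of_notMem hj]
  refine card_le_lisEndingAt ?_ ⟨by simp, ?_⟩
  · intro a ha b hb hab
    rw [Finset.mem_coe, Finset.mem_insert] at ha hb
    rcases ha with rfl | ha <;> rcases hb with rfl | hb
    · exact absurd hab (lt_irrefl _)
    · exact absurd hab (lt_j b hb).asymm
    · exact (ht.monotoneOn ha hi.1 (hi.2 ha)).trans_lt h
    · exact ht ha hb hab
  · intro k hk
    rw [Finset.mem_coe, Finset.mem_insert] at hk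
    rcases hk with rfl | hk
    · exact le_rfl
    · exact (lt_j k hk).le

/-- The Erdős–Szekeres inequality: the longest decreasing subsequence of `π` is the longest
increasing subsequence of the reversal of the values of `π`. -/
theorem le_LIS_mul_LIS_revPerm {n : ℕ} (π : Equiv.Perm (Fin n)) :
    n ≤ LIS π * LIS (Fin.revPerm * π) := by
  let f : Fin n → ℕ × ℕ := fun i => (lisEndingAt π i, lisEndingAt (Fin.revPerm * π) i)
  have ne_of_lt : ∀ i j, i < j → f i ≠ f j := by
    intro i j hij h
    obtain ⟨h₁, h₂⟩ := Prod.ext_iff.1 h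
    rcases lt_or_gt_of_ne (π.injective.ne hij.ne) with hlt | hgt
    · exact (lisEndingAt_lt hij hlt).ne h₁
    · exact (lisEndingAt_lt (π := Fin.revPerm * π) hij (by simpa using hgt)).ne h₂
  have hf : Function.Injective f := by
    intro i j h
    by_contra hne
    rcases lt_or_gt_of_ne hne with hlt | hgt
    · exact ne_of_lt i j hlt h
    · exact ne_of_lt j i hgt h.symm
  have := Finset.card_le_card_of_injOn f (s := Finset.univ)
    (t := Finset.Icc 1 (LIS π) ×ˢ Finset.Icc 1 (LIS (Fin.revPerm * π)))
    (fun i _ => Finset.mem_product.2 ⟨lisEndingAt_mem_Icc _ i, lisEndingAt_mem_Icc _ i⟩) hf.injOn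
  simpa using this

theorem two_mul_sqrt_le_LIS_add_LIS_revPerm {n : ℕ} (π : Equiv.Perm (Fin n)) :
    2 * Real.sqrt n ≤ LIS π + LIS (Fin.revPerm * π) := by
  have h : (n : ℝ) ≤ LIS π * LIS (Fin.revPerm * π) := by
    exact_mod_cast le_LIS_mul_LIS_revPerm π
  refine le_of_sq_le_sq ?_ (by positivity)
  rw [mul_pow, Real.sq_sqrt n.cast_nonneg]
  nlinarith [sq_nonneg ((LIS π : ℝ) - LIS (Fin.revPerm * π))]

/-- **Average-case lower bound for sorting with parallel stacks.** There are a constant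
`c > 0` and an integer `N` such that for all `n ≥ N`, `Σ_π LIS(π) ≥ c·√n·n!`; since the
minimum number of parallel stacks needed to sort `π` equals the length of its longest
increasing subsequence, the average number of parallel stacks required is `Ω(√n)`. -/
theorem stmt_17 : ∃ c : ℝ, 0 < c ∧ ∃ N : ℕ, ∀ n : ℕ, N ≤ n →
    c * Real.sqrt n * (n.factorial : ℝ) ≤ ∑ π : Equiv.Perm (Fin n), (LIS π : ℝ) := by
  refine ⟨1, one_pos, 0, fun n _ => ?_⟩
  have hrev : ∑ π : Equiv.Perm (Fin n), (LIS (Fin.revPerm * π) : ℝ) =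
      ∑ π : Equiv.Perm (Fin n), (LIS π : ℝ) :=
    Equiv.sum_comp (Equiv.mulLeft Fin.revPerm) fun π : Equiv.Perm (Fin n) => (LIS π : ℝ)
  have hsum := Finset.sum_le_sum fun (π : Equiv.Perm (Fin n)) (_ : π ∈ Finset.univ) =>
    two_mul_sqrt_le_LIS_add_LIS_revPerm π
  rw [Finset.sum_add_distrib, hrev, Finset.sum_const, Finset.card_univ, Fintype.card_perm,
    Fintype.card_fin, nsmul_eq_mul] at hsum
  linarith
end

section
/- For every permutation π of {1,…,n}, if Algorithm Parallel-Queue-Sort uses m nonempty queues when run on π, then π has a decreasing subsequence of length m. -/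
/-- One step of Parallel-Queue-Sort: append the incoming element `x` at the rear of
the leftmost queue whose rear element is smaller than `x` (queues are lists with
head = front and last = rear), and place it in a new empty queue to the right of all
used queues if no such queue exists. -/
def pqsStep (queues : List (List ℕ)) (x : ℕ) : List (List ℕ) :=
  match queues with
  | [] => [[x]]
  | q :: rest => if q.getLastD 0 < x then (q ++ [x]) :: rest else q :: pqsStep rest x

/-- The configuration of queues after Parallel-Queue-Sort has processed the whole
input list `l` from left to right, starting from no queues. -/
def pqsRun (l : List ℕ) : List (List ℕ) :=
  l.foldl pqsStep []

/-- Every queue after one step is either an old queue in its old place, or has the new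
element `x` at its rear while all queues to its left have rear at least `x`. -/
theorem getElem?_pqsStep {x k : ℕ} {queues : List (List ℕ)} {q : List ℕ}
    (h : (pqsStep queues x)[k]? = some q) :
    queues[k]? = some q ∨ q.getLastD 0 = x ∧
      ∀ j < k, ∃ r, queues[j]? = some r ∧ x ≤ r.getLastD 0 := by
  induction queues generalizing k with
  | nil =>
    cases k with
    | zero =>
      obtain rfl : [x] = q := by simpa [pqsStep] using h
      simp
    | succ k => simp [pqsStep] at h
  | cons p rest ih =>
    by_cases hp : p.getLastD 0 < x
    · rw [pqsStep, if_pos hp] at h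
      cases k with
      | zero =>
        obtain rfl : p ++ [x] = q := by simpa using h
        simp [List.getLastD_eq_getLast?]
      | succ k => exact Or.inl (by simpa using h)
    · rw [pqsStep, if_neg hp] at h
      cases k with
      | zero => exact Or.inl (by simpa using h)
      | succ k =>
        rcases ih (by simpa using h) with h | ⟨h, hr⟩
        · exact Or.inl (by simpa using h)
        · refine Or.inr ⟨h, fun j hj => ?_⟩
          cases j with
          | zero => exact ⟨p, by simp, not_lt.mp hp⟩
          | succ j => simpa using hr j (by omega)

/-- The rear of the queue with index `k` ends a decreasing subsequence of length `k + 1`. -/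
theorem exists_decreasing_sublist_of_getElem?_pqsRun {l : List ℕ} (hl : l.Nodup) {k : ℕ}
    {q : List ℕ} (hq : (pqsRun l)[k]? = some q) :
    ∃ s : List ℕ, (s ++ [q.getLastD 0]).Sublist l ∧
      (s ++ [q.getLastD 0]).Pairwise (· > ·) ∧ s.length = k := by
  induction l using List.reverseRecOn generalizing k q with
  | nil => simp [pqsRun] at hq
  | append_singleton l x ih =>
    have hnd : l.Nodup := hl.of_append_left
    have hx : x ∉ l := fun hmem => List.disjoint_of_nodup_append hl hmem (by simp)
    have hrun : pqsRun (l ++ [x]) = pqsStep (pqsRun l) x := by simp [pqsRun]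
    rw [hrun] at hq
    rcases getElem?_pqsStep hq with hq | ⟨rfl, hr⟩
    · obtain ⟨s, hs, hd, hlen⟩ := ih hnd hq
      exact ⟨s, hs.trans (List.sublist_append_left _ _), hd, hlen⟩
    · cases k with
      | zero => exact ⟨[], by simp, by simp, rfl⟩
      | succ k =>
        obtain ⟨r, hrk, hle⟩ := hr k (by omega)
        obtain ⟨s, hs, hd, hlen⟩ := ih hnd hrk
        have hmem : r.getLastD 0 ∈ l := hs.subset (by simp)
        have hlt : q.getLastD 0 < r.getLastD 0 :=
          lt_of_le_of_ne hle fun h => hx (h ▸ hmem)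
        refine ⟨s ++ [r.getLastD 0], hs.append (List.Sublist.refl _), ?_, by simp [hlen]⟩
        rw [List.pairwise_append] at hd ⊢
        refine ⟨List.pairwise_append.mpr hd, by simp, fun a ha b hb => ?_⟩
        obtain rfl := List.mem_singleton.mp hb
        rcases List.mem_append.mp ha with ha | ha
        · exact hlt.trans (hd.2.2 a ha _ (by simp))
        · rwa [List.mem_singleton.mp ha]

/-- A decreasing sublist yields the positions of a decreasing subsequence. -/
theorem exists_strictMono_strictAnti_of_sublist {s l : List ℕ} {m : ℕ} (hs : s.Sublist l)
    (hd : s.Pairwise (· > ·)) (hm : s.length = m) :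
    ∃ idx : Fin m → ℕ, StrictMono idx ∧ (∀ i, idx i < l.length) ∧
      StrictAnti (fun i => l.getD (idx i) 0) := by
  subst hm
  obtain ⟨f, hf⟩ := List.sublist_iff_exists_fin_orderEmbedding_get_eq.mp hs
  refine ⟨fun i => f i, fun i j hij => f.strictMono hij, fun i => (f i).isLt,
    fun i j hij => ?_⟩
  have hval : ∀ i, l.getD (f i) 0 = s.get i := fun i => by
    rw [hf i, List.getD_eq_getElem _ _ (f i).isLt, List.get_eq_getElem]
  simp only [hval]
  exact List.pairwise_iff_get.mp hd i j hij

/-- If Algorithm Parallel-Queue-Sort uses `m` (nonempty) queues on a permutation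
`π(1),…,π(n)` of `{1,…,n}`, then the input has a decreasing subsequence of length
`m`: positions `idx 0 < idx 1 < …` whose entries strictly decrease. -/
theorem stmt_18 (n : ℕ) (l : List ℕ) (hl : l.Perm (List.range' 1 n)) (m : ℕ)
    (hm : (pqsRun l).length = m) :
    ∃ idx : Fin m → ℕ, StrictMono idx ∧ (∀ i, idx i < l.length) ∧
      StrictAnti (fun i => l.getD (idx i) 0) := by
  have hnd : l.Nodup := hl.nodup_iff.mpr List.nodup_range'
  cases m with
  | zero => exact ⟨Fin.elim0, fun i => i.elim0, fun i => i.elim0, fun i => i.elim0⟩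
  | succ k =>
    obtain ⟨s, hs, hd, hlen⟩ := exists_decreasing_sublist_of_getElem?_pqsRun hnd
      (List.getElem?_eq_getElem (show k < (pqsRun l).length by omega))
    exact exists_strictMono_strictAnti_of_sublist hs hd (by simp [hlen])
end

section
/- For all integers 1 ≤ m ≤ n, the number of permutations π of {1,…,n} that have a decreasing subsequence of length m is at most C(n,m)² · (n-m)!. Consequently, there exist a constant C > 0 and an integer N such that for all n ≥ N the sum over all permutations π of {1,…,n} of the length of the longest decreasing subsequence of π is at most C · √n · n!, so the average number of queues used by Parallel-Queue-Sort is O(√n). -/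
/-- `LDS π` is the maximum length of a decreasing subsequence of the permutation `π`
of `{1,…,n}`: the largest `m` for which there are indices `i₁ < … < i_m` with
`π i₁ > … > π i_m`. -/
noncomputable def LDS {n : ℕ} (π : Equiv.Perm (Fin n)) : ℕ :=
  sSup {m : ℕ | ∃ s : Fin m → Fin n, StrictMono s ∧ StrictAnti (fun i => π (s i))}

open Finset in
/-- The permutations with prescribed values at `m` distinct points number at most `(n - m)!`. -/
theorem card_perm_prescribed_le {n m : ℕ} (s t : Fin m → Fin n) (hs : Function.Injective s) :
    #{π : Equiv.Perm (Fin n) | ∀ i, π (s i) = t i} ≤ (n - m).factorial := by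
  classical
  rcases Finset.eq_empty_or_nonempty {π : Equiv.Perm (Fin n) | ∀ i, π (s i) = t i} with h | ⟨σ, hσ⟩
  · simp [h]
  have hσ' : ∀ i, σ (s i) = t i := by simpa using hσ
  have hfix : Fintype.card {f : Equiv.Perm (Fin n) // ∀ a, ¬ (a ∉ Set.range s) → f a = a}
      = (n - m).factorial := by
    rw [← Fintype.card_congr (Equiv.Perm.subtypeEquivSubtypePerm (fun a => a ∉ Set.range s)),
      Fintype.card_perm, Fintype.card_subtype_compl]
    have : Fintype.card {x // x ∈ Set.range s} = m := by
      rw [← Nat.card_eq_fintype_card, Nat.card_range_of_injective hs, Nat.card_fin]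
    rw [this, Fintype.card_fin]
  rw [← hfix, ← Fintype.card_coe]
  refine Fintype.card_le_of_injective (fun π => ⟨σ⁻¹ * π.1, ?_⟩) ?_
  · intro a ha
    obtain ⟨i, rfl⟩ := not_not.mp ha
    have hπ : ∀ i, π.1 (s i) = t i := (Finset.mem_filter.mp π.2).2
    simp [hπ, ← hσ']
  · intro π τ h
    exact Subtype.ext (mul_left_cancel (Subtype.ext_iff.mp h))

open Finset in
theorem ncard_perm_decreasing_le (n m : ℕ) :
    {π : Equiv.Perm (Fin n) | ∃ s : Fin m → Fin n,
        StrictMono s ∧ StrictAnti (fun i => π (s i))}.ncard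
      ≤ n.choose m ^ 2 * (n - m).factorial := by
  classical
  let S := {A : Finset (Fin n) // #A = m}
  let e : S → Fin m → Fin n := fun A => A.1.orderEmbOfFin A.2
  have he : ∀ f : Fin m → Fin n, StrictMono f → ∃ A, f = e A := by
    intro f hf
    have hc : #(univ.image f) = m := by simp [card_image_of_injective _ hf.injective]
    exact ⟨⟨_, hc⟩, orderEmbOfFin_unique hc (by simp) hf⟩
  let U : Finset (Equiv.Perm (Fin n)) := (univ : Finset (S × S)).biUnion
    fun p => {π | ∀ i, π (e p.1 i) = e p.2 i.rev}
  have hsub : {π : Equiv.Perm (Fin n) | ∃ s : Fin m → Fin n,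
        StrictMono s ∧ StrictAnti (fun i => π (s i))} ⊆ U := by
    rintro π ⟨s, hs, hπ⟩
    obtain ⟨A, hA⟩ := he s hs
    obtain ⟨B, hB⟩ := he (fun i => π (s i.rev)) fun i j hij => hπ (Fin.rev_lt_rev.mpr hij)
    simp only [U, coe_biUnion, Set.mem_iUnion]
    refine ⟨(A, B), by simp, ?_⟩
    simp [← hA, ← hB]
  have hcard : Fintype.card (S × S) = n.choose m ^ 2 := by
    simp [S, Fintype.card_prod, sq, Fintype.card_finset_len]
  calc _ ≤ (U : Set (Equiv.Perm (Fin n))).ncard := Set.ncard_le_ncard hsub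
    _ = #U := Set.ncard_coe_finset U
    _ ≤ #(univ : Finset (S × S)) * (n - m).factorial :=
      card_biUnion_le_card_mul _ _ _ fun p _ =>
        card_perm_prescribed_le _ _ (p.1.1.orderEmbOfFin p.1.2).injective
    _ = _ := by rw [card_univ, hcard]

theorem LDS_le {n : ℕ} (π : Equiv.Perm (Fin n)) : LDS π ≤ n := by
  refine csSup_le' ?_
  rintro m ⟨s, hs, -⟩
  simpa using Fintype.card_le_of_injective s hs.injective

theorem LDS_le_of_not_exists {n k : ℕ} (π : Equiv.Perm (Fin n))
    (h : ¬ ∃ s : Fin k → Fin n, StrictMono s ∧ StrictAnti (fun i => π (s i))) : LDS π ≤ k := by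
  refine csSup_le' ?_
  rintro m ⟨s, hs, hπ⟩
  by_contra! hm
  exact h ⟨s ∘ Fin.castLE hm.le, hs.comp (Fin.strictMono_castLE hm.le),
    hπ.comp_strictMono (Fin.strictMono_castLE hm.le)⟩

theorem sum_LDS_le (n k : ℕ) :
    ∑ π : Equiv.Perm (Fin n), LDS π
      ≤ k * n.factorial + n * (n.choose k ^ 2 * (n - k).factorial) := by
  classical
  let P : Equiv.Perm (Fin n) → Prop := fun π =>
    ∃ s : Fin k → Fin n, StrictMono s ∧ StrictAnti (fun i => π (s i))
  have hP : (Finset.univ.filter P).card ≤ n.choose k ^ 2 * (n - k).factorial := by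
    rw [← Set.ncard_coe_finset]
    simpa [P] using ncard_perm_decreasing_le n k
  calc ∑ π : Equiv.Perm (Fin n), LDS π
      ≤ ∑ π : Equiv.Perm (Fin n), (k + if P π then n else 0) := by
        refine Finset.sum_le_sum fun π _ => ?_
        split_ifs with h
        · exact (LDS_le π).trans (Nat.le_add_left _ _)
        · exact LDS_le_of_not_exists π h
    _ = k * n.factorial + n * (Finset.univ.filter P).card := by
        rw [Finset.sum_add_distrib, ← Finset.sum_filter]
        simp [Fintype.card_perm, mul_comm]
    _ ≤ _ := by gcongr

theorem choose_sq_mul_factorial_le (n k : ℕ) :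
    ((n.choose k ^ 2 * (n - k).factorial : ℕ) : ℝ)
      ≤ n ^ k / (k.factorial : ℝ) ^ 2 * n.factorial := by
  rcases lt_or_ge n k with h | h
  · rw [Nat.choose_eq_zero_of_lt h]
    simp only [ne_eq, OfNat.ofNat_ne_zero, not_false_eq_true, zero_pow, zero_mul, Nat.cast_zero]
    positivity
  · have h1 : (n.choose k : ℝ) ≤ n ^ k / k.factorial := Nat.choose_le_pow_div k n
    have h2 : (n.choose k : ℝ) * k.factorial * (n - k).factorial = n.factorial := by
      exact_mod_cast Nat.choose_mul_factorial_mul_factorial h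
    have hk : (0 : ℝ) < k.factorial := by positivity
    calc ((n.choose k ^ 2 * (n - k).factorial : ℕ) : ℝ)
        = n.choose k * (n.factorial / k.factorial) := by
          rw [← h2]; push_cast; field_simp
      _ ≤ n ^ k / k.factorial * (n.factorial / k.factorial) := by gcongr
      _ = _ := by field_simp

theorem pow_le_three_pow_mul_factorial (k : ℕ) : (k : ℝ) ^ k ≤ 3 ^ k * k.factorial := by
  have h := Real.pow_div_factorial_le_exp (k : ℝ) (Nat.cast_nonneg k) k
  rw [div_le_iff₀ (by positivity)] at h
  refine h.trans ?_
  gcongr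
  rw [← Real.exp_one_pow]
  exact pow_le_pow_left₀ (Real.exp_pos 1).le (Real.exp_one_lt_d9.le.trans (by norm_num)) k

theorem mul_pow_div_factorial_sq_le_one {n k : ℕ} (h : 36 * n ≤ k ^ 2) :
    (n : ℝ) * (n ^ k / (k.factorial : ℝ) ^ 2) ≤ 1 := by
  have h36 : (36 : ℝ) * n ≤ k ^ 2 := by exact_mod_cast h
  have hn : (n : ℝ) ≤ 4 ^ k := by
    have h2 : k < 2 ^ k := Nat.lt_two_pow_self
    have h4 : (4 : ℕ) ^ k = (2 ^ k) ^ 2 := by rw [← pow_mul, mul_comm, pow_mul]; norm_num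
    have : n ≤ 4 ^ k := by rw [h4]; nlinarith
    exact_mod_cast this
  rw [← mul_div_assoc, div_le_one (by positivity)]
  have h9 : (0 : ℝ) < 9 ^ k := by positivity
  refine le_of_mul_le_mul_left ?_ h9
  calc (9 : ℝ) ^ k * (n * n ^ k) ≤ 9 ^ k * (4 ^ k * n ^ k) := by gcongr
    _ = (36 * n) ^ k := by rw [← mul_assoc, ← mul_pow, ← mul_pow]; norm_num
    _ ≤ ((k : ℝ) ^ 2) ^ k := by gcongr
    _ = ((k : ℝ) ^ k) ^ 2 := by rw [← pow_mul, ← pow_mul, mul_comm]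
    _ ≤ (3 ^ k * k.factorial) ^ 2 := by gcongr; exact pow_le_three_pow_mul_factorial k
    _ = 9 ^ k * (k.factorial : ℝ) ^ 2 := by
      rw [mul_pow, ← pow_mul, mul_comm k, pow_mul]; norm_num

/-- For all `1 ≤ m ≤ n`, the number of permutations of `{1,…,n}` with a decreasing
subsequence of length `m` is at most `C(n,m)² · (n-m)!`; consequently there are
`C > 0` and `N` such that for all `n ≥ N` the sum over all permutations of the length
of the longest decreasing subsequence is at most `C·√n·n!`, so the average number of
queues used by Parallel-Queue-Sort is `O(√n)`. -/
theorem stmt_19 :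
    (∀ n m : ℕ, 1 ≤ m → m ≤ n →
      {π : Equiv.Perm (Fin n) | ∃ s : Fin m → Fin n,
          StrictMono s ∧ StrictAnti (fun i => π (s i))}.ncard
        ≤ n.choose m ^ 2 * (n - m).factorial) ∧
    ∃ C : ℝ, 0 < C ∧ ∃ N : ℕ, ∀ n : ℕ, N ≤ n →
      (∑ π : Equiv.Perm (Fin n), (LDS π : ℝ)) ≤ C * Real.sqrt n * (n.factorial : ℝ) := by
  refine ⟨fun n m _ _ => ncard_perm_decreasing_le n m, 8, by norm_num, 1, fun n hn => ?_⟩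
  set k := ⌈6 * Real.sqrt n⌉₊
  have hsqrt : 1 ≤ Real.sqrt n := Real.one_le_sqrt.mpr (by exact_mod_cast hn)
  have hk : 6 * Real.sqrt n ≤ k := Nat.le_ceil _
  have hk' : (k : ℝ) < 6 * Real.sqrt n + 1 := Nat.ceil_lt_add_one (by positivity)
  have hkn : 36 * n ≤ k ^ 2 := by
    have hsq : Real.sqrt n ^ 2 = n := Real.sq_sqrt (Nat.cast_nonneg n)
    have : (36 : ℝ) * n ≤ k ^ 2 := by nlinarith
    exact_mod_cast this
  calc (∑ π : Equiv.Perm (Fin n), (LDS π : ℝ))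
      ≤ k * n.factorial + n * ((n.choose k ^ 2 * (n - k).factorial : ℕ) : ℝ) := by
        exact_mod_cast sum_LDS_le n k
    _ ≤ k * n.factorial + n * (n ^ k / (k.factorial : ℝ) ^ 2 * n.factorial) := by
        gcongr
        exact choose_sq_mul_factorial_le n k
    _ = (k + n * (n ^ k / (k.factorial : ℝ) ^ 2)) * n.factorial := by ring
    _ ≤ (8 * Real.sqrt n) * n.factorial := by
        gcongr
        linarith [mul_pow_div_factorial_sq_le_one hkn]
end
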